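/- Let G be a finite solvable group, let p be a prime, and let H be a maximal subgroup of G whose index |G : H| is a power of p. Suppose K is a subgroup of G isomorphic to H (as abstract groups). If O_p(G) is not contained in H, then K is a maximal subgroup of G. (Lemma 2.2) -/

import Mathlib

/-- `O_p(G)`: the `p`-core of `G`, i.e. the largest normal `p`-subgroup of `G`
(for finite `G` the join of all normal `p`-subgroups is the largest one). -/
def pCore (p : ℕ) (G : Type*) [Group G] : Subgroup G :=
  sSup {N : Subgroup G | N.Normal ∧ IsPGroup p N}

namespace Subgroup

variable {G G' : Type*} [Group G] [Group G']

/-- `A` is a maximal proper `K`-invariant subgroup of the `K`-invariant subgroup `B`. -/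
structure InvCovBy (K A B : Subgroup G) : Prop where
  left_inv : K ≤ normalizer (A : Set G)
  right_inv : K ≤ normalizer (B : Set G)
  lt : A < B
  eq_or_eq : ∀ D : Subgroup G, K ≤ normalizer (D : Set G) → A ≤ D → D ≤ B → D = A ∨ D = B

/-- There is an unrefinable chain of `K`-invariant subgroups of length `n` from `⊥` to the given
subgroup. -/
inductive HasInvLength (K : Subgroup G) : Subgroup G → ℕ → Prop
  | bot : HasInvLength K ⊥ 0
  | step {A B : Subgroup G} {n : ℕ} :
      HasInvLength K A n → InvCovBy K A B → HasInvLength K B (n + 1)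

theorem HasInvLength.le_normalizer {K A : Subgroup G} {n : ℕ} (h : HasInvLength K A n) :
    K ≤ normalizer (A : Set G) := by
  cases h with
  | bot => exact le_normalizer_of_normal
  | step _ h => exact h.right_inv

/-- A subgroup `A` contains `B` as soon as it contains every element of `B` that centralizes `B`
modulo `A`, provided `B` is normalized by a nilpotent overgroup `P`. -/
theorem le_of_forall_commutator_mem {P A B : Subgroup G} [Group.IsNilpotent P] (hBP : B ≤ P)
    (hPB : P ≤ normalizer (B : Set G))
    (h : ∀ z ∈ B, (∀ x ∈ P, z * x * z⁻¹ * x⁻¹ ∈ A) → z ∈ A) : B ≤ A := by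
  obtain ⟨n, hn⟩ := Group.IsNilpotent.nilpotent P
  have key : ∀ i, ∀ z : P, z ∈ upperCentralSeries P i → (z : G) ∈ B → (z : G) ∈ A := by
    intro i
    induction i with
    | zero =>
      intro z hz _
      rw [upperCentralSeries_zero, mem_bot] at hz
      simp [hz, A.one_mem]
    | succ i ih =>
      intro z hz hzB
      refine h z hzB fun x hx => ?_
      have h1 := ih _ (mem_upperCentralSeries_succ_iff.1 hz ⟨x, hx⟩)
      simp only [commutatorElement_def, coe_mul, coe_inv] at h1
      refine h1 ?_
      have h2 := le_normalizer_iff.1 hPB x hx _ (B.inv_mem hzB)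
      have h3 := B.mul_mem hzB h2
      simpa [mul_assoc] using h3
  intro b hb
  exact key n ⟨b, hBP hb⟩ (by rw [hn]; trivial) hb

theorem InvCovBy.le_normalizer {K A B : Subgroup G} [Group.IsNilpotent B]
    (h : InvCovBy K A B) : B ≤ normalizer (A : Set G) := by
  have hinf : K ≤ normalizer ((normalizer (A : Set G) ⊓ B : Subgroup G) : Set G) :=
    (le_inf (h.left_inv.trans Subgroup.le_normalizer) h.right_inv).trans
      inf_normalizer_le_normalizer_inf
  rcases h.eq_or_eq _ hinf (le_inf Subgroup.le_normalizer h.lt.le) inf_le_right with h1 | h1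
  · refine absurd ?_ h.lt.not_ge
    refine le_of_forall_commutator_mem le_rfl Subgroup.le_normalizer fun z hz hzA => ?_
    rw [← h1]
    refine mem_inf.2 ⟨?_, hz⟩
    have hle : ∀ y ∈ A, z * y * z⁻¹ ∈ A := fun y hy => by
      simpa using A.mul_mem (hzA y (h.lt.le hy)) hy
    rw [mem_normalizer_iff]
    refine fun y => ⟨hle y, fun hy => ?_⟩
    have hyB : y ∈ B := by
      have := B.mul_mem (B.mul_mem (B.inv_mem hz) (h.lt.le hy)) hz
      simpa [mul_assoc] using this
    have := A.mul_mem (A.inv_mem (hzA y hyB)) hy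
    simpa [mul_assoc] using this
  · exact inf_eq_right.1 h1

theorem InvCovBy.inf_left {K A B C : Subgroup G} [Group.IsNilpotent C]
    (hA : InvCovBy K A C) (hB : InvCovBy K B C) (hne : A ≠ B) : InvCovBy K (A ⊓ B) A where
  left_inv := (le_inf hA.left_inv hB.left_inv).trans inf_normalizer_le_normalizer_inf
  right_inv := hA.left_inv
  lt := by
    refine lt_of_le_of_ne inf_le_left fun h => ?_
    rcases hA.eq_or_eq B hB.left_inv (inf_eq_left.1 h) hB.lt.le with h1 | h1
    · exact hne h1.symm
    · exact hB.lt.ne h1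
  eq_or_eq := by
    intro D hD hABD hDA
    have hsup : K ≤ normalizer ((D ⊔ B : Subgroup G) : Set G) :=
      (le_inf hD hB.left_inv).trans (normalizer_inf_normalizer_le_normalizer_sup D B)
    rcases hB.eq_or_eq _ hsup le_sup_right (sup_le (hDA.trans hA.lt.le) hB.lt.le) with h | h
    · exact Or.inl (le_antisymm (le_inf hDA (sup_eq_right.1 h)) hABD)
    · refine Or.inr (le_antisymm hDA fun a ha => ?_)
      have ha' : a ∈ ((D ⊔ B : Subgroup G) : Set G) := by
        rw [h]; exact hA.lt.le ha
      rw [coe_mul_of_left_le_normalizer_right D B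
        ((hDA.trans hA.lt.le).trans hB.le_normalizer)] at ha'
      obtain ⟨d, hd, b, hb, rfl⟩ := ha'
      refine D.mul_mem hd (hABD ⟨?_, hb⟩)
      simpa using A.mul_mem (A.inv_mem (hDA hd)) ha

/-- An invariant subgroup lying strictly above one of length `m` has a length exceeding `m`. -/
theorem HasInvLength.exists_of_lt [Finite G] {K A B : Subgroup G} {m : ℕ}
    (hA : HasInvLength K A m) (hB : K ≤ normalizer (B : Set G)) (hAB : A < B) :
    ∃ n, m < n ∧ HasInvLength K B n := by
  induction B using WellFoundedLT.induction with
  | _ B ih =>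
  by_cases h : ∃ D : Subgroup G, K ≤ normalizer (D : Set G) ∧ A < D ∧ D < B
  · obtain ⟨C, ⟨hC, hAC, hCB⟩, hmax⟩ := Set.Finite.exists_maximal (Set.toFinite
      {D : Subgroup G | K ≤ normalizer (D : Set G) ∧ A < D ∧ D < B}) h
    obtain ⟨n, hn, hlen⟩ := ih C hCB hC hAC
    refine ⟨n + 1, by omega, hlen.step ⟨hC, hB, hCB, fun D hD hCD hDB => ?_⟩⟩
    rcases hDB.eq_or_lt with h1 | h1
    · exact Or.inr h1
    · exact Or.inl (le_antisymm (hmax ⟨hD, hAC.trans_le hCD, h1⟩ hCD) hCD)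
  · refine ⟨m + 1, by omega, hA.step ⟨hA.le_normalizer, hB, hAB, fun D hD hAD hDB => ?_⟩⟩
    by_contra! hne
    exact h ⟨D, hD, lt_of_le_of_ne hAD hne.1.symm, lt_of_le_of_ne hDB hne.2⟩

theorem exists_hasInvLength [Finite G] {K B : Subgroup G} (hB : K ≤ normalizer (B : Set G)) :
    ∃ n, HasInvLength K B n := by
  rcases eq_bot_or_bot_lt B with rfl | h
  · exact ⟨0, .bot⟩
  · obtain ⟨n, -, hn⟩ := HasInvLength.bot.exists_of_lt hB h
    exact ⟨n, hn⟩

/-- Jordan–Hölder for invariant subgroups of a `p`-group: the length is well defined. -/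
theorem HasInvLength.unique [Finite G] {p : ℕ} [Fact p.Prime] {K B : Subgroup G}
    (hp : IsPGroup p B) {m n : ℕ} (hm : HasInvLength K B m) (hn : HasInvLength K B n) :
    m = n := by
  induction B using WellFoundedLT.induction generalizing m n with
  | _ B ih =>
  cases hm with
  | bot =>
    cases hn with
    | bot => rfl
    | step _ h => exact absurd h.lt not_lt_bot
  | @step A _ m hA hAB =>
    cases hn with
    | bot => exact absurd hAB.lt not_lt_bot
    | @step C _ n hC hCB =>
      have hpA := hp.to_le hAB.lt.le
      have hpC := hp.to_le hCB.lt.le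
      by_cases hne : A = C
      · subst hne
        rw [ih A hAB.lt hpA hA hC]
      · have : Group.IsNilpotent B := hp.isNilpotent
        have h1 := hAB.inf_left hCB hne
        have h2 := hCB.inf_left hAB (Ne.symm hne)
        rw [inf_comm] at h2
        obtain ⟨k, hk⟩ := exists_hasInvLength h1.left_inv
        rw [ih A hAB.lt hpA hA (hk.step h1), ih C hCB.lt hpC hC (hk.step h2)]

theorem map_le_normalizer_map_iff {f : G →* G'} (hf : Function.Injective f)
    {K A : Subgroup G} :
    K.map f ≤ normalizer (A.map f : Set G') ↔ K ≤ normalizer (A : Set G) := by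
  rw [le_normalizer_iff, le_normalizer_iff]
  simp only [mem_map, forall_exists_index, and_imp, forall_apply_eq_imp_iff₂, ← map_mul,
    ← map_inv, hf.eq_iff, exists_eq_right]

theorem InvCovBy.map {f : G →* G'} (hf : Function.Injective f) {K A B : Subgroup G}
    (h : InvCovBy K A B) : InvCovBy (K.map f) (A.map f) (B.map f) where
  left_inv := (map_le_normalizer_map_iff hf).2 h.left_inv
  right_inv := (map_le_normalizer_map_iff hf).2 h.right_inv
  lt := (map_lt_map_iff_of_injective hf).2 h.lt
  eq_or_eq := by
    intro D hD hAD hDB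
    obtain ⟨E, rfl⟩ : ∃ E : Subgroup G, E.map f = D :=
      ⟨D.comap f, map_comap_eq_self (hDB.trans (map_le_range f B))⟩
    rw [map_le_normalizer_map_iff hf] at hD
    rw [map_le_map_iff_of_injective hf] at hAD hDB
    exact (h.eq_or_eq E hD hAD hDB).imp (congrArg _) (congrArg _)

theorem HasInvLength.map {f : G →* G'} (hf : Function.Injective f) {K A : Subgroup G} {n : ℕ}
    (h : HasInvLength K A n) : HasInvLength (K.map f) (A.map f) n := by
  induction h with
  | bot => rw [map_bot]; exact .bot
  | step _ h ih => exact ih.step (h.map hf)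

/-- Chief factors of `G` inside a nilpotent normal subgroup `P` stay irreducible under every
supplement `K` of `P`. -/
theorem InvCovBy.of_sup_eq_top {K P A B : Subgroup G} [P.Normal] [Group.IsNilpotent P]
    (hKP : K ⊔ P = ⊤) (hBP : B ≤ P) (h : InvCovBy ⊤ A B) : InvCovBy K A B where
  left_inv := le_top.trans h.left_inv
  right_inv := le_top.trans h.right_inv
  lt := h.lt
  eq_or_eq := by
    have hA : A.Normal := normalizer_eq_top_iff.1 (top_le_iff.1 h.left_inv)
    have hB : B.Normal := normalizer_eq_top_iff.1 (top_le_iff.1 h.right_inv)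
    have hcomm : ∀ z ∈ B, ∀ x ∈ P, z * x * z⁻¹ * x⁻¹ ∈ A := by
      let π := QuotientGroup.mk' A
      let C : Subgroup G := B ⊓ (centralizer (P.map π : Set (G ⧸ A))).comap π
      have hPn : (P.map π).Normal := Normal.map ‹_› π (QuotientGroup.mk'_surjective A)
      have hC : C.Normal := inferInstance
      have hmem : ∀ z, z ∈ C ↔ z ∈ B ∧ ∀ x ∈ P, z * x * z⁻¹ * x⁻¹ ∈ A := by
        intro z
        refine and_congr_right fun _ => ?_
        change (∀ y ∈ P.map π, y * π z = π z * y) ↔ _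
        constructor
        · intro hz x hx
          have := hz (π x) (mem_map_of_mem π hx)
          rw [← QuotientGroup.eq_one_iff]
          change π (z * x * z⁻¹ * x⁻¹) = 1
          rw [map_mul, map_mul, map_mul, ← this]
          simp
        · rintro hz _ ⟨x, hx, rfl⟩
          have := (QuotientGroup.eq_one_iff _).2 (hz x hx)
          change π (z * x * z⁻¹ * x⁻¹) = 1 at this
          rw [map_mul, map_mul, map_mul, map_inv, map_inv, mul_inv_eq_one,
            mul_inv_eq_iff_eq_mul] at this
          exact this.symm
      have hAC : A ≤ C := fun a ha => (hmem a).2 ⟨h.lt.le ha, fun x _ => by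
        simpa [mul_assoc] using A.mul_mem ha (hA.conj_mem _ (A.inv_mem ha) x)⟩
      rcases h.eq_or_eq C le_normalizer_of_normal hAC inf_le_left with h1 | h1
      · exact absurd (le_of_forall_commutator_mem hBP le_normalizer_of_normal
          fun z hz hzA => h1 ▸ (hmem z).2 ⟨hz, hzA⟩) h.lt.not_ge
      · exact fun z hz => ((hmem z).1 (h1 ▸ hz)).2
    intro D hD hAD hDB
    refine h.eq_or_eq D (hKP ▸ sup_le hD (le_normalizer_iff.2 fun x hx d hd => ?_)) hAD hDB
    have h1 := D.mul_mem (hAD (A.inv_mem (hcomm d (hDB hd) x hx))) hd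
    simpa [mul_assoc] using h1

theorem HasInvLength.of_sup_eq_top {K P A : Subgroup G} [P.Normal] [Group.IsNilpotent P]
    (hKP : K ⊔ P = ⊤) {n : ℕ} (h : HasInvLength ⊤ A n) (hAP : A ≤ P) : HasInvLength K A n := by
  induction h with
  | bot => exact .bot
  | step _ h ih => exact (ih (h.lt.le.trans hAP)).step (h.of_sup_eq_top hKP hAP)

/-- The invariant subgroups between `K ⊓ P` and `P` correspond to the subgroups above `K`. -/
theorem isCoatom_iff_invCovBy {K P : Subgroup G} [P.Normal] (hKP : K ⊔ P = ⊤) :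
    IsCoatom K ↔ InvCovBy K (K ⊓ P) P := by
  have hinf : ∀ M, K ≤ M → K ≤ normalizer ((M ⊓ P : Subgroup G) : Set G) := fun M hM =>
    (le_inf (hM.trans le_normalizer) le_normalizer_of_normal).trans
      inf_normalizer_le_normalizer_inf
  have hdecomp : ∀ g : G, ∃ k ∈ K, ∃ x ∈ P, k * x = g := fun g =>
    mem_sup_of_normal_right.1 (hKP ▸ mem_top g)
  constructor
  · intro h
    refine ⟨hinf K le_rfl, le_normalizer_of_normal, lt_of_le_of_ne inf_le_right fun h1 => ?_, ?_⟩
    · exact h.1 (by rwa [sup_eq_left.2 (inf_eq_right.1 h1)] at hKP)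
    · intro D hD hKD hDP
      have hmem : ∀ g ∈ K ⊔ D, ∃ k ∈ K, ∃ d ∈ D, k * d = g := fun g hg => by
        have : g ∈ ((K ⊔ D : Subgroup G) : Set G) := hg
        rwa [coe_mul_of_left_le_normalizer_right K D hD] at this
      rcases h.le_iff.1 (le_sup_left : K ≤ K ⊔ D) with h1 | h1
      · refine Or.inr (le_antisymm hDP fun x hx => ?_)
        obtain ⟨k, hk, d, hd, rfl⟩ := hmem x (h1 ▸ mem_top x)
        refine D.mul_mem (hKD ⟨hk, ?_⟩) hd
        simpa using P.mul_mem hx (P.inv_mem (hDP hd))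
      · exact Or.inl (le_antisymm (le_inf (sup_eq_left.1 h1) hDP) hKD)
  · intro h
    refine ⟨fun h1 => h.lt.ne (by rw [h1, top_inf_eq]), fun M hM => ?_⟩
    rcases h.eq_or_eq (M ⊓ P) (hinf M hM.le) (inf_le_inf_right P hM.le) inf_le_right with h1 | h1
    · refine absurd (fun m hm => ?_) hM.not_ge
      obtain ⟨k, hk, x, hx, rfl⟩ := hdecomp m
      have hxM : x ∈ M := by simpa using M.mul_mem (M.inv_mem (hM.le hk)) hm
      exact K.mul_mem hk (h1.le ⟨hxM, hx⟩).1
    · exact top_le_iff.1 (hKP ▸ sup_le hM.le (inf_eq_right.1 h1))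

end Subgroup

open Subgroup

section pCore

variable {G : Type*} [Group G] {p : ℕ}

theorem le_pCore {N : Subgroup G} (hN : N.Normal) (hp : IsPGroup p N) : N ≤ pCore p G :=
  le_sSup ⟨hN, hp⟩

theorem map_pCore_le {G' : Type*} [Group G'] (e : G ≃* G') :
    (pCore p G).map e.toMonoidHom ≤ pCore p G' := by
  rw [pCore, sSup_eq_iSup', Subgroup.map_iSup]
  exact iSup_le fun N => le_pCore (N.2.1.map _ e.surjective) (N.2.2.map _)

theorem map_pCore_equiv {G' : Type*} [Group G'] (e : G ≃* G') :
    (pCore p G).map e.toMonoidHom = pCore p G' := by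
  refine le_antisymm (map_pCore_le e) fun x hx => ?_
  have := map_pCore_le e.symm (mem_map_of_mem _ hx)
  exact ⟨_, this, e.apply_symm_apply x⟩

instance pCore_normal : (pCore p G).Normal := by
  refine ⟨fun _ hx g => ?_⟩
  exact map_pCore_le (MulAut.conj g) (mem_map_of_mem _ hx)

theorem isPGroup_pCore [Finite G] [Fact p.Prime] : IsPGroup p (pCore p G) := by
  obtain ⟨S⟩ : Nonempty (Sylow p G) := inferInstance
  refine S.isPGroup'.to_le (sSup_le fun N hN => ?_)
  have := hN.1
  have h := hN.2.to_sup_of_normal_left S.isPGroup'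
  exact sup_eq_right.1 (S.is_maximal' h le_sup_right)

theorem pCore_subgroupOf_le [Finite G] [Fact p.Prime] (H : Subgroup G) :
    (pCore p G).subgroupOf H ≤ pCore p H :=
  le_pCore inferInstance isPGroup_pCore.comap_subtype

/-- If `H` supplements the `p`-core of `G`, then the `p`-core of `H` is its intersection with that
of `G`. -/
theorem pCore_eq_subgroupOf [Finite G] [Fact p.Prime] {H : Subgroup G}
    (hH : H ⊔ pCore p G = ⊤) : pCore p H = (pCore p G).subgroupOf H := by
  refine le_antisymm ?_ (pCore_subgroupOf_le H)
  rw [subgroupOf, ← map_le_iff_le_comap]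
  have hinv : H ≤ normalizer ((pCore p H).map H.subtype : Set G) := by
    have := (map_le_normalizer_map_iff (K := ⊤) (A := pCore p H) H.subtype_injective).2
      le_normalizer_of_normal
    rwa [← MonoidHom.range_eq_map, range_subtype] at this
  refine le_sup_left.trans (le_pCore (N := (pCore p H).map H.subtype ⊔ pCore p G) ?_
    ((isPGroup_pCore.map _).to_sup_of_normal_right isPGroup_pCore))
  rw [← normalizer_eq_top_iff, ← top_le_iff, ← hH]
  exact sup_le ((le_inf hinv le_normalizer_of_normal).trans
    (normalizer_inf_normalizer_le_normalizer_sup _ _)) (le_sup_right.trans Subgroup.le_normalizer)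

/-- Every subgroup isomorphic to a supplement of the `p`-core is itself such a supplement. -/
theorem sup_pCore_eq_top_of_mulEquiv [Finite G] [Fact p.Prime] {H K : Subgroup G} (e : H ≃* K)
    (hH : H ⊔ pCore p G = ⊤) : K ⊔ pCore p G = ⊤ := by
  set P := pCore p G
  have hcard : Nat.card (P.subgroupOf K) ≤ Nat.card (P.subgroupOf H) := by
    rw [← pCore_eq_subgroupOf hH, ← card_map_of_injective (f := e.toMonoidHom) e.injective,
      map_pCore_equiv e]
    exact card_le_of_le (pCore_subgroupOf_le K)
  have h1 : Nat.card (P.subgroupOf K) * P.relIndex K =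
      Nat.card (P.subgroupOf H) * P.relIndex H := by
    rw [relIndex, relIndex, card_mul_index, card_mul_index, Nat.card_congr e.toEquiv]
  have h2 : P.relIndex H = P.index := by
    rw [← relIndex_sup_right, hH, relIndex_top_right]
  have h3 : P.index ≤ P.relIndex K := by
    by_contra! hlt
    rw [h2] at h1
    exact absurd h1 (Nat.mul_lt_mul_of_le_of_lt hcard hlt Nat.card_pos).ne
  rw [← relIndex_sup_right] at h3
  have h4 := relIndex_mul_index (le_sup_right : P ≤ K ⊔ P)
  rw [← index_eq_one]
  have h5 : 0 < P.index := Nat.pos_of_ne_zero P.index_ne_zero_of_finite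
  have h6 : 0 < (K ⊔ P).index := Nat.pos_of_ne_zero (K ⊔ P).index_ne_zero_of_finite
  nlinarith

end pCore

/-- **Lemma 2.2.** Let `H` be a maximal subgroup of a finite solvable group `G` of index a
power of the prime `p`, and let `K ≤ G` with `K ≅ H`.  If `O_p(G)` is not contained in `H`,
then `K` is maximal in `G`. -/
theorem maximal_of_pCore_not_le
    (G : Type) [Group G] [Finite G] (hG : IsSolvable G)
    (p : ℕ) (hp : p.Prime)
    (H : Subgroup G) (hH : IsCoatom H) (hidx : ∃ n : ℕ, H.index = p ^ n)
    (K : Subgroup G) (hiso : Nonempty (H ≃* K))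
    (hnle : ¬ pCore p G ≤ H) :
    IsCoatom K := by
  have : Fact p.Prime := ⟨hp⟩
  obtain ⟨e⟩ := hiso
  have hHP : H ⊔ pCore p G = ⊤ :=
    hH.2 _ (lt_of_le_of_ne le_sup_left fun h => hnle (h ▸ le_sup_right))
  have hKP := sup_pCore_eq_top_of_mulEquiv e hHP
  have hP : IsPGroup p (pCore p G) := isPGroup_pCore
  have : Group.IsNilpotent (pCore p G) := hP.isNilpotent
  obtain ⟨n, hn⟩ := exists_hasInvLength (K := ⊤) (B := pCore p G) le_normalizer_of_normal
  obtain ⟨m, hm⟩ := exists_hasInvLength (K := ⊤) (B := pCore p H) le_normalizer_of_normal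
  have hmK := hm.map (f := e.toMonoidHom) e.injective
  rw [map_top_of_surjective _ e.surjective, map_pCore_equiv e] at hmK
  have transfer : ∀ L : Subgroup G, L ⊔ pCore p G = ⊤ → HasInvLength ⊤ (pCore p L) m →
      HasInvLength L (L ⊓ pCore p G) m := fun L hL h => by
    have := h.map L.subtype_injective
    rwa [← MonoidHom.range_eq_map, range_subtype, pCore_eq_subgroupOf hL,
      subgroupOf_map_subtype, inf_comm] at this
  have hnm : n = m + 1 := (hn.of_sup_eq_top hHP le_rfl).unique hP
    ((transfer H hHP hm).step ((isCoatom_iff_invCovBy hHP).1 hH))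
  have hK := transfer K hKP hmK
  refine (isCoatom_iff_invCovBy hKP).2
    ⟨hK.le_normalizer, le_normalizer_of_normal, lt_of_le_of_ne inf_le_right fun h => ?_, ?_⟩
  · rw [h] at hK
    have := hK.unique hP (hn.of_sup_eq_top hKP le_rfl)
    omega
  · intro D hD hKD hDP
    by_contra! hne
    obtain ⟨k, hk, hDk⟩ := hK.exists_of_lt hD (lt_of_le_of_ne hKD hne.1.symm)
    obtain ⟨l, hl, hPl⟩ := hDk.exists_of_lt (B := pCore p G) le_normalizer_of_normal
      (lt_of_le_of_ne hDP hne.2)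
    have := hPl.unique hP (hn.of_sup_eq_top hKP le_rfl)
    omega
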